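/- For every integer j ≥ 1, every real d > 0, and all reals 2 ≤ P < Q ≤ 2P, the sum of a_j(n; P, Q) · d^{Ω(n)} / n over squarefull positive integers n is at most (12 d² j / (P log P))^{j/2} · { 1 + (j log P / (54 P))^{j/6} }. -/

import Mathlib

/-- `aj j P Q n` counts the `j`-tuples `(p₁, …, p_j)` of prime numbers with
`P < pᵢ ≤ Q` for all `i` and `p₁ ⋯ p_j = n`. -/
noncomputable def aj (j : ℕ) (P Q : ℝ) (n : ℕ) : ℕ :=
  Nat.card {f : Fin j → ℕ //
    (∀ i, (f i).Prime ∧ P < (f i : ℝ) ∧ (f i : ℝ) ≤ Q) ∧ ∏ i, f i = n}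

/-- `bigOmega n` is the number of prime factors of `n` counted with multiplicity. -/
def bigOmega (n : ℕ) : ℕ := n.primeFactorsList.length

/-- A positive integer is squarefull if every prime dividing it does so to at least
the second power (in particular, `1` is squarefull). -/
def Squarefull (n : ℕ) : Prop := 0 < n ∧ ∀ p : ℕ, p.Prime → p ∣ n → p ^ 2 ∣ n

/-- Every value taken by `f` is taken at least twice. -/
def TwicePlus {ι X : Type*} (f : ι → X) : Prop := ∀ i, ∃ k, k ≠ i ∧ f k = f i

theorem card_constant_on_le {ι X : Type} [Fintype ι] [Fintype X] (S : Finset ι) (i₀ : ι) :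
    Nat.card {f : ι → X // (∀ i ∈ S, f i = f i₀) ∧ TwicePlus fun i : {i // i ∉ S} => f i} ≤
      Fintype.card X * Nat.card {g : {i // i ∉ S} → X // TwicePlus g} := by
  classical
  rw [← Nat.card_eq_fintype_card (α := X), ← Nat.card_prod]
  refine Nat.card_le_card_of_injective
    (fun f => (f.1 i₀, ⟨fun i => f.1 i, f.2.2⟩)) ?_
  rintro ⟨f, hf, hf'⟩ ⟨g, hg, hg'⟩ h
  simp only [Prod.mk.injEq, Subtype.mk.injEq] at h
  ext i
  by_cases hi : i ∈ S
  · change f i = g i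
    rw [hf i hi, hg i hi, h.1]
  · exact congrFun h.2 ⟨i, hi⟩

theorem TwicePlus.exists_constant_on {ι X : Type} [Fintype ι] [DecidableEq ι]
    {f : ι → X} (hf : TwicePlus f) (i₀ : ι) :
    (∃ a, i₀ ≠ a ∧ (∀ i ∈ ({i₀, a} : Finset ι), f i = f i₀) ∧
      TwicePlus fun i : {i // i ∉ ({i₀, a} : Finset ι)} => f i) ∨
    (∃ a b, (i₀ ≠ a ∧ i₀ ≠ b ∧ a ≠ b) ∧ (∀ i ∈ ({i₀, a, b} : Finset ι), f i = f i₀) ∧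
      TwicePlus fun i : {i // i ∉ ({i₀, a, b} : Finset ι)} => f i) := by
  classical
  obtain ⟨a, ha, hfa⟩ := hf i₀
  by_cases h : ∃ b, (i₀ ≠ b ∧ a ≠ b) ∧ f b = f i₀ ∧ ∀ c, f c = f i₀ → c = i₀ ∨ c = a ∨ c = b
  · obtain ⟨b, ⟨hb, hab⟩, hfb, hall⟩ := h
    refine Or.inr ⟨a, b, ⟨ha.symm, hb, hab⟩, by simp [hfa, hfb], ?_⟩
    rintro ⟨i, hi⟩
    obtain ⟨k, hk, hfk⟩ := hf i
    refine ⟨⟨k, fun hkm => hi ?_⟩, by simpa using hk, hfk⟩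
    have : f k = f i₀ := by
      simp only [Finset.mem_insert, Finset.mem_singleton] at hkm
      rcases hkm with rfl | rfl | rfl <;> simp [hfa, hfb]
    simpa using hall i (hfk.symm.trans this)
  · refine Or.inl ⟨a, ha.symm, by simp [hfa], ?_⟩
    rintro ⟨i, hi⟩
    simp only [Finset.mem_insert, Finset.mem_singleton, not_or] at hi
    by_cases hfi : f i = f i₀
    · push Not at h
      obtain ⟨c, hc, h1, h2, h3⟩ := h i ⟨Ne.symm hi.1, Ne.symm hi.2⟩ hfi
      exact ⟨⟨c, by simp [h1, h2]⟩, by simpa using h3, hc.trans hfi.symm⟩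
    · obtain ⟨k, hk, hfk⟩ := hf i
      refine ⟨⟨k, fun hkm => hfi ?_⟩, by simpa using hk, hfk⟩
      simp only [Finset.mem_insert, Finset.mem_singleton] at hkm
      rcases hkm with rfl | rfl <;> simp [← hfk, hfa]

theorem card_twicePlus_le {X : Type} [Fintype X] {j : ℕ} {W : ℝ} (hW : 0 < W)
    (h : j * Fintype.card X * W + (j : ℝ) ^ 2 * Fintype.card X ≤ W ^ 3) (k : ℕ) (hk : k ≤ j)
    (ι : Type) [Fintype ι] (hι : Fintype.card ι = k) :
    (Nat.card {f : ι → X // TwicePlus f} : ℝ) ≤ W ^ k := by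
  classical
  induction k using Nat.strong_induction_on generalizing ι with
  | _ k ih =>
  rcases isEmpty_or_nonempty ι with hemp | ⟨⟨i₀⟩⟩
  · have : k = 0 := by rw [← hι]; simp
    subst this
    have : Nat.card {f : ι → X // TwicePlus f} ≤ 1 :=
      Finite.card_le_one_iff_subsingleton.2 inferInstance
    simpa using this
  let G : Finset ι → Finset (ι → X) := fun S => Finset.univ.filter fun f =>
    (∀ i ∈ S, f i = f i₀) ∧ TwicePlus fun i : {i // i ∉ S} => f i
  have hG (S : Finset ι) (hS : 0 < S.card) :
      ((G S).card : ℝ) * W ^ S.card ≤ Fintype.card X * W ^ k := by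
    have hSk : S.card ≤ k := hι ▸ S.card_le_univ
    have h1 : (G S).card ≤ Fintype.card X * Nat.card {g : {i // i ∉ S} → X // TwicePlus g} := by
      refine le_trans (le_of_eq ?_) (card_constant_on_le S i₀)
      rw [Nat.card_eq_fintype_card, Fintype.card_subtype]
    have h2 := ih (k - S.card) (by omega) (by omega) {i // i ∉ S} (by simp [hι])
    calc ((G S).card : ℝ) * W ^ S.card
        ≤ (Fintype.card X * Nat.card {g : {i // i ∉ S} → X // TwicePlus g} : ℝ) * W ^ S.card := by
          gcongr; exact_mod_cast h1
      _ ≤ (Fintype.card X * W ^ (k - S.card)) * W ^ S.card := by gcongr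
      _ = Fintype.card X * W ^ k := by rw [mul_assoc, ← pow_add, Nat.sub_add_cancel hSk]
  let A : Finset ι := Finset.univ.filter fun a => i₀ ≠ a
  let B : Finset (ι × ι) := Finset.univ.filter fun a => i₀ ≠ a.1 ∧ i₀ ≠ a.2 ∧ a.1 ≠ a.2
  have hsub : (Finset.univ.filter fun f : ι → X => TwicePlus f) ⊆
      (A.biUnion fun a => G {i₀, a}) ∪ (B.biUnion fun a => G {i₀, a.1, a.2}) := by
    intro f hf
    rw [Finset.mem_filter] at hf
    rw [Finset.mem_union, Finset.mem_biUnion, Finset.mem_biUnion]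
    rcases hf.2.exists_constant_on i₀ with ⟨a, ha, h1, h2⟩ | ⟨a, b, hab, h1, h2⟩
    · exact Or.inl ⟨a, by simp [A, ha], Finset.mem_filter.2 ⟨Finset.mem_univ _, h1, h2⟩⟩
    · exact Or.inr ⟨(a, b), by simp [B, hab],
        Finset.mem_filter.2 ⟨Finset.mem_univ _, h1, h2⟩⟩
  have hcard : (Nat.card {f : ι → X // TwicePlus f} : ℝ) ≤
      ∑ a ∈ A, ((G {i₀, a}).card : ℝ) + ∑ a ∈ B, ((G {i₀, a.1, a.2}).card : ℝ) := by
    rw [Nat.card_eq_fintype_card, Fintype.card_subtype]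
    exact_mod_cast (Finset.card_le_card hsub).trans ((Finset.card_union_le _ _).trans
      (add_le_add Finset.card_biUnion_le Finset.card_biUnion_le))
  have hA : ∑ a ∈ A, ((G {i₀, a}).card : ℝ) * W ^ 2 ≤ k * (Fintype.card X * W ^ k) := by
    calc _ ≤ ∑ a ∈ A, Fintype.card X * W ^ k := by
          refine Finset.sum_le_sum fun a ha => ?_
          have := hG {i₀, a} (by simp)
          rwa [Finset.card_pair (Finset.mem_filter.1 ha).2] at this
      _ ≤ k * (Fintype.card X * W ^ k) := by
          rw [Finset.sum_const, nsmul_eq_mul]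
          gcongr
          exact hι ▸ A.card_le_univ
  have hB : ∑ a ∈ B, ((G {i₀, a.1, a.2}).card : ℝ) * W ^ 3 ≤
      (k : ℝ) ^ 2 * (Fintype.card X * W ^ k) := by
    calc _ ≤ ∑ a ∈ B, Fintype.card X * W ^ k := by
          refine Finset.sum_le_sum fun a ha => ?_
          have := hG {i₀, a.1, a.2} (by simp)
          rwa [Finset.card_eq_three.2 ⟨i₀, a.1, a.2, (Finset.mem_filter.1 ha).2.1,
            (Finset.mem_filter.1 ha).2.2.1, (Finset.mem_filter.1 ha).2.2.2, rfl⟩] at this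
      _ ≤ (k : ℝ) ^ 2 * (Fintype.card X * W ^ k) := by
          rw [Finset.sum_const, nsmul_eq_mul]
          gcongr
          have : B.card ≤ k ^ 2 := by
            refine B.card_le_univ.trans ?_
            rw [Fintype.card_prod, hι, sq]
          exact_mod_cast this
  rw [← Finset.sum_mul] at hA hB
  have hkj : (k : ℝ) ≤ j := by exact_mod_cast hk
  refine le_of_mul_le_mul_right ?_ (pow_pos hW 3)
  calc _ ≤ (∑ a ∈ A, ((G {i₀, a}).card : ℝ) + ∑ a ∈ B, ((G {i₀, a.1, a.2}).card : ℝ)) * W ^ 3 := by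
        gcongr
    _ = (∑ a ∈ A, ((G {i₀, a}).card : ℝ)) * W ^ 2 * W +
        (∑ a ∈ B, ((G {i₀, a.1, a.2}).card : ℝ)) * W ^ 3 := by ring
    _ ≤ k * (Fintype.card X * W ^ k) * W + (k : ℝ) ^ 2 * (Fintype.card X * W ^ k) := by gcongr
    _ = W ^ k * (k * Fintype.card X * W + (k : ℝ) ^ 2 * Fintype.card X) := by ring
    _ ≤ W ^ k * (j * Fintype.card X * W + (j : ℝ) ^ 2 * Fintype.card X) := by gcongr
    _ ≤ W ^ k * W ^ 3 := by gcongr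

/-- The primes `p` with `P < p ≤ Q`. -/
noncomputable def primesBetween (P Q : ℝ) : Finset ℕ :=
  {p ∈ Finset.Icc 1 ⌊Q⌋₊ | p.Prime ∧ P < p}

theorem mem_primesBetween {P Q : ℝ} {p : ℕ} :
    p ∈ primesBetween P Q ↔ p.Prime ∧ P < (p : ℝ) ∧ (p : ℝ) ≤ Q := by
  rw [primesBetween, Finset.mem_filter, Finset.mem_Icc]
  constructor
  · rintro ⟨⟨h1, h2⟩, h3, h4⟩
    exact ⟨h3, h4, (Nat.le_floor_iff' (by omega)).1 h2⟩
  · rintro ⟨h1, h2, h3⟩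
    exact ⟨⟨h1.pos, Nat.le_floor h3⟩, h1, h2⟩

theorem card_primesBetween_mul_log_le {P Q : ℝ} (hP : 2 ≤ P) (hQ : Q ≤ 2 * P) :
    (primesBetween P Q).card * Real.log P ≤ 2.8 * P := by
  have h1 : P ^ (primesBetween P Q).card ≤ (4 : ℝ) ^ (2 * P) := by
    calc P ^ (primesBetween P Q).card ≤ ∏ p ∈ primesBetween P Q, (p : ℝ) := by
          rw [← Finset.prod_const]
          exact Finset.prod_le_prod (fun _ _ => by linarith)
            fun p hp => (mem_primesBetween.1 hp).2.1.le
      _ ≤ (primorial ⌊2 * P⌋₊ : ℕ) := by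
          rw [← Nat.cast_prod, primorial]
          refine Nat.cast_le.2 (Finset.prod_le_prod_of_subset_of_one_le' ?_ ?_)
          · intro p hp
            obtain ⟨h1, -, h3⟩ := mem_primesBetween.1 hp
            exact Finset.mem_filter.2
              ⟨Finset.mem_range.2 (Nat.lt_succ_of_le (Nat.le_floor (h3.trans hQ))), h1⟩
          · intro p hp _
            exact (Finset.mem_filter.1 hp).2.pos
      _ ≤ (4 : ℝ) ^ ⌊2 * P⌋₊ := by exact_mod_cast primorial_le_four_pow _
      _ ≤ (4 : ℝ) ^ (2 * P) := by
          rw [← Real.rpow_natCast]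
          exact Real.rpow_le_rpow_of_exponent_le (by norm_num) (Nat.floor_le (by linarith))
  have h2 := Real.log_le_log (by positivity) h1
  rw [Real.log_pow, Real.log_rpow (by norm_num), show (4 : ℝ) = 2 ^ 2 by norm_num,
    Real.log_pow] at h2
  have := Real.log_two_lt_d9
  push_cast at h2
  nlinarith

theorem twicePlus_of_squarefull_prod {j : ℕ} {f : Fin j → ℕ} (hf : ∀ i, (f i).Prime)
    (h : Squarefull (∏ i, f i)) : TwicePlus f := by
  intro i
  have h1 := h.2 (f i) (hf i) (Finset.dvd_prod_of_mem f (Finset.mem_univ i))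
  rw [← Finset.mul_prod_erase _ f (Finset.mem_univ i), sq,
    Nat.mul_dvd_mul_iff_left (hf i).pos, (hf i).prime.dvd_finsetProd_iff] at h1
  obtain ⟨k, hk, hdvd⟩ := h1
  exact ⟨k, Finset.ne_of_mem_erase hk, ((Nat.prime_dvd_prime_iff_eq (hf i) (hf k)).1 hdvd).symm⟩

theorem bigOmega_prod_primes {j : ℕ} {f : Fin j → ℕ} (hf : ∀ i, (f i).Prime) :
    bigOmega (∏ i, f i) = j := by
  rw [bigOmega, ← ArithmeticFunction.cardFactors_apply, Finset.prod_eq_multiset_prod,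
    ArithmeticFunction.cardFactors_multiset_prod]
  · simp [List.sum_ofFn, ArithmeticFunction.cardFactors_apply_prime (hf _)]
  · exact Finset.prod_ne_zero_iff.2 fun i _ => (hf i).ne_zero

open Classical in
theorem aj_le_card (j : ℕ) (P Q : ℝ) {n : ℕ} (hn : Squarefull n) :
    aj j P Q n ≤ (Finset.univ.filter fun f : Fin j → primesBetween P Q =>
      TwicePlus f ∧ ∏ i, (f i : ℕ) = n).card := by
  rw [aj, ← Fintype.card_subtype, ← Nat.card_eq_fintype_card]
  refine Nat.card_le_card_of_injective
    (fun f => ⟨fun i => ⟨f.1 i, mem_primesBetween.2 (f.2.1 i)⟩, fun i => ?_, f.2.2⟩) ?_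
  · obtain ⟨k, hk, h⟩ :=
      twicePlus_of_squarefull_prod (fun i => (f.2.1 i).1) (by rwa [f.2.2]) i
    exact ⟨k, hk, Subtype.ext h⟩
  · intro f g h
    ext i
    simp only [Subtype.mk.injEq] at h
    exact congrArg Subtype.val (congrFun h i)

theorem aj_mul_pow_div_le {j : ℕ} {d P Q : ℝ} (hd : 0 < d) (hP : 0 < P) (n : ℕ) :
    aj j P Q n * d ^ bigOmega n / n ≤ aj j P Q n * (d / P) ^ j := by
  rcases Nat.eq_zero_or_pos (aj j P Q n) with h | h
  · simp [h]
  obtain ⟨⟨f, hf, rfl⟩⟩ := (Nat.card_pos_iff.1 h).1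
  rw [bigOmega_prod_primes fun i => (hf i).1, mul_div_assoc, div_pow]
  gcongr
  push_cast
  calc P ^ j = ∏ _i : Fin j, P := by simp
    _ ≤ ∏ i, (f i : ℝ) := Finset.prod_le_prod (fun _ _ => hP.le) fun i _ => (hf i).2.1.le

open Classical in
theorem tsum_squarefull_le (j : ℕ) {d P Q : ℝ} (hd : 0 < d) (hP : 0 < P) :
    ∑' n : ℕ, (if Squarefull n then (aj j P Q n : ℝ) * d ^ bigOmega n / n else 0) ≤
      Nat.card {f : Fin j → primesBetween P Q // TwicePlus f} * (d / P) ^ j := by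
  let F : Finset (Fin j → primesBetween P Q) := Finset.univ.filter fun f => TwicePlus f
  let I : Finset ℕ := F.image fun f => ∏ i, (f i : ℕ)
  have hle (n : ℕ) (hn : Squarefull n) :
      aj j P Q n ≤ (F.filter fun f => ∏ i, (f i : ℕ) = n).card := by
    rw [Finset.filter_filter]
    exact aj_le_card j P Q hn
  rw [tsum_eq_sum (s := I)]
  · calc _ ≤ ∑ n ∈ I, ((F.filter fun f => ∏ i, (f i : ℕ) = n).card : ℝ) * (d / P) ^ j := by
          refine Finset.sum_le_sum fun n _ => ?_
          split_ifs with h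
          · refine (aj_mul_pow_div_le hd hP n).trans ?_
            gcongr
            exact hle n h
          · positivity
      _ = _ := by
          rw [← Finset.sum_mul, Nat.card_eq_fintype_card, Fintype.card_subtype]
          congr 1
          exact_mod_cast (Finset.card_eq_sum_card_fiberwise
            fun f hf => Finset.mem_image_of_mem _ hf).symm
  · intro n hn
    split_ifs with h
    · have h0 : aj j P Q n = 0 := by
        refine Nat.le_zero.1 ((hle n h).trans (le_of_eq ?_))
        rw [Finset.card_eq_zero, Finset.filter_eq_empty_iff]
        exact fun f hf h => hn (Finset.mem_image.2 ⟨f, hf, h⟩)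
      simp [h0]
    · rfl

open Classical in
theorem stmt2 (j : ℕ) (hj : 1 ≤ j) (d : ℝ) (hd : 0 < d) (P Q : ℝ)
    (hP : 2 ≤ P) (hPQ : P < Q) (hQ : Q ≤ 2 * P) :
    ∑' n : ℕ, (if Squarefull n then (aj j P Q n : ℝ) * d ^ bigOmega n / n else 0) ≤
      (12 * d ^ 2 * j / (P * Real.log P)) ^ ((j : ℝ) / 2) *
        (1 + (j * Real.log P / (54 * P)) ^ ((j : ℝ) / 6)) := by
  have hP0 : 0 < P := by linarith
  have hL : 0 < Real.log P := Real.log_pos (by linarith)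
  have hj0 : (0 : ℝ) < j := by exact_mod_cast hj
  have hN := card_primesBetween_mul_log_le hP hQ
  set L := Real.log P with hLdef
  set N : ℝ := ((primesBetween P Q).card : ℝ) with hNdef
  have hN' : N ≤ 2.8 * P / L := (le_div_iff₀ hL).2 hN
  set s : ℝ := (12 * j / (P * L)) ^ (1 / 2 : ℝ) with hs
  set t : ℝ := (j * L / (54 * P)) ^ (1 / 6 : ℝ) with ht
  have hs0 : 0 < s := by positivity
  have ht0 : 0 < t := by positivity
  have hs2 : s ^ 2 = 12 * j / (P * L) := by
    rw [hs, ← Real.rpow_natCast, ← Real.rpow_mul (by positivity)]; norm_num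
  have ht6 : t ^ 6 = j * L / (54 * P) := by
    rw [ht, ← Real.rpow_natCast, ← Real.rpow_mul (by positivity)]; norm_num
  have hst : 5.6 * j ^ 2 / (P ^ 2 * L) ≤ (s * t) ^ 3 := by
    refine le_of_sq_le_sq ?_ (by positivity)
    have h6 : ((s * t) ^ 3) ^ 2 = 32 * j ^ 4 / (P ^ 4 * L ^ 2) := by
      rw [show ((s * t) ^ 3) ^ 2 = (s ^ 2) ^ 3 * t ^ 6 by ring, hs2, ht6]
      field_simp
      norm_num
    rw [h6, div_pow, show (P ^ 2 * L) ^ 2 = P ^ 4 * L ^ 2 by ring, mul_pow, ← pow_mul]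
    gcongr
    norm_num
  set M : ℝ := max s (s * t) with hM
  have hM0 : 0 < M := lt_max_of_lt_left hs0
  have hM2 : 12 * j / (P * L) ≤ M ^ 2 := hs2 ▸ pow_le_pow_left₀ hs0.le (le_max_left _ _) 2
  have hM3 : 5.6 * j ^ 2 / (P ^ 2 * L) ≤ M ^ 3 :=
    hst.trans (pow_le_pow_left₀ (by positivity) (le_max_right _ _) 3)
  have hcard := card_twicePlus_le (X := primesBetween P Q) (j := j) (W := P * M) (by positivity)
    (by
      rw [Fintype.card_coe, ← hNdef]
      calc j * N * (P * M) + (j : ℝ) ^ 2 * N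
          ≤ j * (2.8 * P / L) * (P * M) + (j : ℝ) ^ 2 * (2.8 * P / L) := by gcongr
        _ = P ^ 3 * M * (2.8 / 12) * (12 * j / (P * L)) +
            P ^ 3 * (1 / 2) * (5.6 * j ^ 2 / (P ^ 2 * L)) := by
          field_simp
          ring
        _ ≤ P ^ 3 * M * (2.8 / 12) * M ^ 2 + P ^ 3 * (1 / 2) * M ^ 3 := by gcongr
        _ ≤ (P * M) ^ 3 := by nlinarith [pow_pos (mul_pos hP0 hM0) 3])
    j le_rfl (Fin j) (Fintype.card_fin j)
  have hsum : M ^ j ≤ s ^ j * (1 + t ^ j) := by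
    rw [mul_add, mul_one, ← mul_pow]
    rcases max_choice s (s * t) with h | h <;> rw [hM, h]
    · exact le_add_of_nonneg_right (by positivity)
    · exact le_add_of_nonneg_left (by positivity)
  have hds : (12 * d ^ 2 * j / (P * L)) ^ ((j : ℝ) / 2) = (d * s) ^ j := by
    rw [show 12 * d ^ 2 * j / (P * L) = (d * s) ^ 2 by rw [mul_pow, hs2]; ring,
      ← Real.rpow_natCast (d * s) 2, ← Real.rpow_mul (by positivity), ← Real.rpow_natCast]
    congr 1
    push_cast
    ring
  have htj : (j * L / (54 * P)) ^ ((j : ℝ) / 6) = t ^ j := by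
    rw [← ht6, ← Real.rpow_natCast t 6, ← Real.rpow_mul (by positivity), ← Real.rpow_natCast]
    congr 1
    push_cast
    ring
  calc _ ≤ _ := tsum_squarefull_le j hd hP0
    _ ≤ (P * M) ^ j * (d / P) ^ j := by gcongr
    _ = d ^ j * M ^ j := by
      rw [← mul_pow, ← mul_pow]
      congr 1
      field_simp
    _ ≤ d ^ j * (s ^ j * (1 + t ^ j)) := by gcongr
    _ = _ := by rw [hds, htj, mul_pow, mul_assoc]
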